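/- For all integers 1 ≤ k ≤ n, the number of diagrams λ ∈ Y_{k,n} with o(λ) < n equals − Σ_{d | gcd(k,n), d > 1} μ(d)·C(n/d, k/d), where the sum runs over all common divisors d > 1 of k and n and μ is the Möbius function. -/

import Mathlib

/-- A Young diagram inscribed in a `k × (n-k)` rectangle: a weakly decreasing
sequence `λ₁ ≥ … ≥ λ_k` (0-indexed) with all entries `≤ n - k`. -/
def IsDiagram (k n : ℕ) (lam : Fin k → ℕ) : Prop :=
  (∀ i j : Fin k, i ≤ j → lam j ≤ lam i) ∧ ∀ i, lam i ≤ n - k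

/-- The cyclic step map `σ` on diagrams: add one box to every row if the first
row is shorter than `n - k`, otherwise drop the first row and append a zero row. -/
def cyc (k n : ℕ) (lam : Fin k → ℕ) : Fin k → ℕ :=
  if ∀ i, lam i < n - k then fun i => lam i + 1
  else fun i => if h : (i : ℕ) + 1 < k then lam ⟨(i : ℕ) + 1, h⟩ else 0

/-- The orbit length `o(λ)`: the least positive `t` with `σ^[t] λ = λ`. -/
noncomputable def orbLen (k n : ℕ) (lam : Fin k → ℕ) : ℕ :=
  sInf {t | 0 < t ∧ (cyc k n)^[t] lam = lam}

/-- Upper triangular diagram: `k·λᵢ ≤ (n-k)(k-i)` for all `i` (1-indexed). -/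
def IsUpper (k n : ℕ) (lam : Fin k → ℕ) : Prop :=
  ∀ i : Fin k, k * lam i ≤ (n - k) * (k - 1 - (i : ℕ))

/-- Lexicographic (non-strict) comparison of diagrams. -/
def lexLE {k : ℕ} (lam mu : Fin k → ℕ) : Prop :=
  lam = mu ∨ ∃ t : Fin k, (∀ i, i < t → lam i = mu i) ∧ lam t < mu t

/-- Minimal upper triangular diagram: upper triangular and lexicographically
smallest among the upper triangular diagrams in its `σ`-orbit. -/
def IsMinUpper (k n : ℕ) (lam : Fin k → ℕ) : Prop :=
  IsUpper k n lam ∧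
    ∀ t : ℕ, IsUpper k n ((cyc k n)^[t] lam) → lexLE lam ((cyc k n)^[t] lam)

/-- The binary word of a diagram: position `j` (0-indexed) carries the symbol `0`
(encoded as `false`) iff `j = λ_{k-i} + i` for some `0 ≤ i ≤ k-1` (0-indexed). -/
def word (k n : ℕ) (lam : Fin k → ℕ) (j : Fin n) : Bool :=
  !decide (∃ i : Fin k, (j : ℕ) = lam i.rev + (i : ℕ))

/-- A binary word of length `n` with exactly `k` zeros (`false` encodes `0`). -/
def IsWord (k n : ℕ) (w : Fin n → Bool) : Prop :=
  (Finset.univ.filter fun j => w j = false).card = k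

/-- Rotation of a binary word: `r(w)_j = w_{j+1}`, indices mod `n`. -/
def rot {n : ℕ} (w : Fin n → Bool) (j : Fin n) : Bool :=
  w ⟨((j : ℕ) + 1) % n, Nat.mod_lt _ j.pos⟩

/-- The diagram `θ_{k,km} = ((k-1)(m-1), (k-2)(m-1), …, (m-1), 0)`. -/
def theta (k m : ℕ) : Fin k → ℕ := fun i => (k - 1 - (i : ℕ)) * (m - 1)

/-- `N_{k,n}`: the number of diagrams in `Y_{k,n}` with full orbit `o(λ) = n`. -/
noncomputable def NN (k n : ℕ) : ℕ :=
  {lam : Fin k → ℕ | IsDiagram k n lam ∧ orbLen k n lam = n}.ncard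

/-- Translation by one of a subset of `ZMod n`. -/
def shift (n : ℕ) (S : Finset (ZMod n)) : Finset (ZMod n) := S.image (· + 1)

theorem shift_iterate (n t : ℕ) (S : Finset (ZMod n)) :
    (shift n)^[t] S = S.image (· + (t : ZMod n)) := by
  induction t with
  | zero => simp
  | succ t ih =>
    rw [Function.iterate_succ_apply', ih, shift, Finset.image_image]
    congr 1
    funext x
    simp [add_assoc]

/-- The subset of `ZMod n` of positions of the vertical steps in the boundary of a diagram. -/
def stepSet (k n : ℕ) (lam : Fin k → ℕ) : Finset (ZMod n) :=
  Finset.univ.image fun i : Fin k => ((lam i + (k - 1 - (i : ℕ)) : ℕ) : ZMod n)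

theorem StrictMono.add_sub_le_of_fin {k : ℕ} {f : Fin k → ℕ} (hf : StrictMono f) (i j : Fin k)
    (hij : i ≤ j) : f i + ((j : ℕ) - (i : ℕ)) ≤ f j := by
  obtain ⟨j, hj⟩ := j
  induction j with
  | zero =>
    have : i = ⟨0, hj⟩ := le_antisymm hij (by simp [Fin.le_def])
    simp [this]
  | succ j ih =>
    rcases hij.eq_or_lt with rfl | h
    · simp
    · have h1 : (i : ℕ) < j + 1 := h
      have h2 := ih (by omega) (by rw [Fin.le_def]; simp only; omega)
      have h3 : f ⟨j, by omega⟩ < f ⟨j + 1, hj⟩ := hf (by simp [Fin.lt_def])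
      simp only at h2 ⊢
      omega

theorem IsDiagram.cyc {k n : ℕ} {lam : Fin k → ℕ} (h : IsDiagram k n lam) :
    IsDiagram k n (cyc k n lam) := by
  unfold _root_.cyc
  split_ifs with hc
  · exact ⟨fun i j hij => by have := h.1 i j hij; simpa using this, fun i => hc i⟩
  · refine ⟨fun i j hij => ?_, fun i => ?_⟩
    · have hij' : (i : ℕ) ≤ j := hij
      simp only
      split_ifs with h1 h2
      · exact h.1 _ _ (by simp only [Fin.le_def]; omega)
      · omega
      all_goals simp
    · simp only
      split_ifs
      · exact h.2 _
      · simp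

theorem stepSet_cyc {k n : ℕ} (hk : 1 ≤ k) (hkn : k ≤ n) {lam : Fin k → ℕ}
    (h : IsDiagram k n lam) : stepSet k n (cyc k n lam) = shift n (stepSet k n lam) := by
  unfold cyc
  split_ifs with hc
  · rw [stepSet, shift, stepSet, Finset.image_image]
    congr 1
    funext i
    simp only [Function.comp]
    push_cast
    ring
  · have h0 : lam ⟨0, hk⟩ = n - k := by
      refine le_antisymm (h.2 _) ?_
      push Not at hc
      obtain ⟨i, hi⟩ := hc
      exact hi.trans (h.1 _ _ (by simp [Fin.le_def]))
    ext x
    simp only [stepSet, shift, Finset.mem_image, Finset.mem_univ, true_and,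
      exists_exists_eq_and]
    constructor
    · rintro ⟨i, rfl⟩
      by_cases hi : (i : ℕ) + 1 < k
      · refine ⟨⟨i + 1, hi⟩, ?_⟩
        rw [dif_pos hi, ← Nat.cast_add_one]
        congr 1
        simp only
        omega
      · refine ⟨⟨0, hk⟩, ?_⟩
        rw [dif_neg hi, h0, ← Nat.cast_add_one]
        have e1 : n - k + (k - 1 - 0) + 1 = n := by omega
        have e2 : 0 + (k - 1 - (i : ℕ)) = 0 := by omega
        simp only [e1, e2]
        simp
    · rintro ⟨i, rfl⟩
      rcases Nat.eq_zero_or_pos (i : ℕ) with hi | hi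
      · refine ⟨⟨k - 1, by omega⟩, ?_⟩
        have hi' : i = ⟨0, hk⟩ := Fin.ext hi
        subst hi'
        rw [dif_neg (by simp only; omega), h0, ← Nat.cast_add_one]
        have e1 : n - k + (k - 1 - 0) + 1 = n := by omega
        simp only [e1]
        simp
      · refine ⟨⟨i - 1, by omega⟩, ?_⟩
        have hi1 : (i : ℕ) - 1 + 1 < k := by omega
        rw [dif_pos hi1, ← Nat.cast_add_one]
        have e : (⟨(i : ℕ) - 1 + 1, hi1⟩ : Fin k) = i := Fin.ext (by simp only; omega)
        simp only [e]
        congr 1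
        omega

theorem IsDiagram.strictAnti {k n : ℕ} {lam : Fin k → ℕ} (h : IsDiagram k n lam) :
    StrictAnti fun i : Fin k => lam i + (k - 1 - (i : ℕ)) := by
  intro i j hij
  have h1 := h.1 i j hij.le
  have h2 : (i : ℕ) < j := hij
  simp only
  omega

theorem IsDiagram.lt {k n : ℕ} (hkn : k ≤ n) {lam : Fin k → ℕ} (h : IsDiagram k n lam)
    (i : Fin k) : lam i + (k - 1 - (i : ℕ)) < n := by
  have := h.2 i
  omega

theorem card_stepSet {k n : ℕ} (hkn : k ≤ n) {lam : Fin k → ℕ} (h : IsDiagram k n lam) :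
    (stepSet k n lam).card = k := by
  rw [stepSet, Finset.card_image_of_injective, Finset.card_univ, Fintype.card_fin]
  intro i j hij
  refine h.strictAnti.injective ?_
  have := congrArg ZMod.val hij
  simpa only [ZMod.val_natCast, Nat.mod_eq_of_lt (h.lt hkn _)] using this

theorem stepSet_injOn {k n : ℕ} (hkn : k ≤ n) :
    Set.InjOn (stepSet k n) {lam | IsDiagram k n lam} := by
  intro lam h mu h' he
  have key : ∀ {lam : Fin k → ℕ}, IsDiagram k n lam →
      Set.range (fun i : Fin k => lam i + (k - 1 - (i : ℕ))) =
        ((stepSet k n lam).image ZMod.val : Finset ℕ) := by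
    intro lam h
    ext x
    simp [stepSet, -Nat.cast_add, ZMod.val_natCast, Nat.mod_eq_of_lt (h.lt hkn _)]
  have hr := (key h).trans ((congrArg (fun S : Finset (ZMod n) =>
    ((S.image ZMod.val : Finset ℕ) : Set ℕ)) he).trans (key h').symm)
  rw [h.strictAnti.range_inj h'.strictAnti] at hr
  funext i
  have := congrFun hr i
  omega

theorem exists_stepSet_eq {k n : ℕ} [NeZero n] (S : Finset (ZMod n)) (hS : S.card = k) :
    ∃ lam : Fin k → ℕ, IsDiagram k n lam ∧ stepSet k n lam = S := by
  have hT : (S.image ZMod.val).card = k := by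
    rw [Finset.card_image_of_injective _ (ZMod.val_injective n), hS]
  set e := (S.image ZMod.val).orderEmbOfFin hT with he
  have hgap := e.strictMono.add_sub_le_of_fin
  have hlt : ∀ i, e i < n := fun i => by
    have := Finset.orderEmbOfFin_mem (S.image ZMod.val) hT i
    obtain ⟨x, -, hx⟩ := Finset.mem_image.1 this
    rw [he, ← hx]
    exact ZMod.val_lt x
  have hge : ∀ i : Fin k, (i : ℕ) ≤ e i := fun i => by
    have := hgap ⟨0, i.pos⟩ i (by simp [Fin.le_def])
    simp only at this
    omega
  refine ⟨fun i => e i.rev - (k - 1 - (i : ℕ)), ⟨fun i j hij => ?_, fun i => ?_⟩, ?_⟩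
  · have h1 := hgap j.rev i.rev (Fin.rev_le_rev.2 hij)
    have h2 := hge j.rev
    have hij' : (i : ℕ) ≤ j := hij
    simp only [Fin.val_rev] at h1 h2 ⊢
    omega
  · have hpos := i.pos
    have h1 := hgap i.rev ⟨k - 1, by omega⟩ (by simp only [Fin.le_def, Fin.val_rev]; omega)
    have h2 := hlt ⟨k - 1, by omega⟩
    simp only [Fin.val_rev] at h1 ⊢
    omega
  · have hval : ∀ i : Fin k, e i.rev - (k - 1 - (i : ℕ)) + (k - 1 - (i : ℕ)) = e i.rev := by
      intro i
      have := hge i.rev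
      simp only [Fin.val_rev] at this
      omega
    have himg : Finset.univ.image (fun i : Fin k => e i.rev) = S.image ZMod.val := by
      rw [← Finset.image_orderEmbOfFin_univ (S.image ZMod.val) hT]
      ext x
      simp only [Finset.mem_image, Finset.mem_univ, true_and]
      exact ⟨fun ⟨i, hi⟩ => ⟨i.rev, hi⟩, fun ⟨i, hi⟩ => ⟨i.rev, by simpa using hi⟩⟩
    simp only [stepSet, hval]
    have : (fun i : Fin k => ((e i.rev : ℕ) : ZMod n)) =
        (fun m : ℕ => (m : ZMod n)) ∘ fun i : Fin k => e i.rev := rfl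
    rw [this, ← Finset.image_image, himg, Finset.image_image]
    have hid : (fun m : ℕ => (m : ZMod n)) ∘ ZMod.val = id := by
      funext x
      simp
    rw [hid, Finset.image_id]

theorem stepSet_cyc_iterate {k n : ℕ} (hk : 1 ≤ k) (hkn : k ≤ n) {lam : Fin k → ℕ}
    (h : IsDiagram k n lam) (t : ℕ) :
    IsDiagram k n ((cyc k n)^[t] lam) ∧
      stepSet k n ((cyc k n)^[t] lam) = (shift n)^[t] (stepSet k n lam) := by
  induction t with
  | zero => exact ⟨h, rfl⟩
  | succ t ih =>
    simp only [Function.iterate_succ_apply']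
    exact ⟨ih.1.cyc, by rw [stepSet_cyc hk hkn ih.1, ih.2]⟩

theorem shift_isPeriodicPt (n : ℕ) (S : Finset (ZMod n)) :
    Function.IsPeriodicPt (shift n) n S := by
  simp [Function.IsPeriodicPt, Function.IsFixedPt, shift_iterate]

theorem orbLen_eq_minimalPeriod {k n : ℕ} (hk : 1 ≤ k) (hkn : k ≤ n) {lam : Fin k → ℕ}
    (h : IsDiagram k n lam) :
    orbLen k n lam = Function.minimalPeriod (shift n) (stepSet k n lam) := by
  have hiff : ∀ t, (cyc k n)^[t] lam = lam ↔
      Function.IsPeriodicPt (shift n) t (stepSet k n lam) := by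
    intro t
    obtain ⟨h1, h2⟩ := stepSet_cyc_iterate hk hkn h t
    rw [Function.IsPeriodicPt, Function.IsFixedPt, ← h2]
    exact ((stepSet_injOn hkn).eq_iff h1 h).symm
  have hpos : 0 < Function.minimalPeriod (shift n) (stepSet k n lam) :=
    (shift_isPeriodicPt n _).minimalPeriod_pos (by omega)
  simp only [orbLen, hiff]
  refine le_antisymm (Nat.sInf_le ⟨hpos, Function.isPeriodicPt_minimalPeriod _ _⟩) ?_
  refine le_csInf ⟨_, hpos, Function.isPeriodicPt_minimalPeriod _ _⟩ ?_
  rintro t ⟨ht, hper⟩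
  exact hper.minimalPeriod_le ht

theorem ncard_short_eq {k n : ℕ} [NeZero n] (hk : 1 ≤ k) (hkn : k ≤ n) :
    {lam : Fin k → ℕ | IsDiagram k n lam ∧ orbLen k n lam < n}.ncard =
      ((Finset.univ.powersetCard k).filter fun S : Finset (ZMod n) =>
        Function.minimalPeriod (shift n) S < n).card := by
  rw [← Set.ncard_coe_finset]
  refine Set.ncard_congr (fun lam _ => stepSet k n lam) ?_ ?_ ?_
  · rintro lam ⟨h, ho⟩
    rw [orbLen_eq_minimalPeriod hk hkn h] at ho
    simp [Finset.mem_powersetCard, card_stepSet hkn h, ho]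
  · intro a b ha hb hab
    exact stepSet_injOn hkn ha.1 hb.1 hab
  · intro S hS
    simp only [Finset.coe_filter, Finset.mem_powersetCard, Finset.subset_univ, true_and,
      Set.mem_ofPred_eq] at hS
    obtain ⟨lam, h, rfl⟩ := exists_stepSet_eq S hS.1
    exact ⟨lam, ⟨h, by rw [orbLen_eq_minimalPeriod hk hkn h]; exact hS.2⟩, rfl⟩

theorem card_filter_castHom_mem {t d : ℕ} [NeZero t] [NeZero (t * d)] (U : Finset (ZMod t)) :
    (Finset.univ.filter fun x : ZMod (t * d) =>
      ZMod.castHom (dvd_mul_right t d) (ZMod t) x ∈ U).card = d * U.card := by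
  classical
  set f := ZMod.castHom (dvd_mul_right t d) (ZMod t) with hf
  have hsurj : Function.Surjective f := ZMod.castHom_surjective _
  have hfib : ∀ u : ZMod t, (Finset.univ.filter fun x => f x = u).card =
      (Finset.univ.filter fun x => f x = 0).card := fun u =>
    AddMonoidHom.card_fiber_eq_of_mem_range f.toAddMonoidHom (hsurj u) (hsurj 0)
  have hsum : ∀ U : Finset (ZMod t), (Finset.univ.filter fun x => f x ∈ U).card =
      U.card * (Finset.univ.filter fun x => f x = 0).card := by
    intro U
    rw [Finset.card_eq_sum_card_fiberwise (f := f) (t := U) (fun x hx => by simpa using hx)]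
    rw [Finset.sum_congr rfl (g := fun _ => (Finset.univ.filter fun x => f x = 0).card)]
    · simp
    · intro u hu
      rw [← hfib u, Finset.filter_filter]
      congr 1
      ext x
      simp only [Finset.mem_filter, Finset.mem_univ, true_and]
      exact ⟨fun h => h.2, fun h => ⟨h ▸ hu, h⟩⟩
  have htot := hsum Finset.univ
  simp only [Finset.mem_univ, Finset.filter_true, Finset.card_univ, ZMod.card] at htot
  rw [hsum, ← Nat.eq_of_mul_eq_mul_left (NeZero.pos t) htot, mul_comm]

theorem card_filter_isPeriodicPt {t d k : ℕ} [NeZero t] [NeZero (t * d)] :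
    ((Finset.univ.powersetCard k).filter fun S : Finset (ZMod (t * d)) =>
        Function.IsPeriodicPt (shift (t * d)) t S).card =
      if d ∣ k then t.choose (k / d) else 0 := by
  classical
  have hd : 0 < d := Nat.pos_of_ne_zero fun h => NeZero.ne (t * d) (by simp [h])
  set f := ZMod.castHom (dvd_mul_right t d) (ZMod t) with hf
  have hsurj : Function.Surjective f := ZMod.castHom_surjective _
  let pre : Finset (ZMod t) → Finset (ZMod (t * d)) := fun U => Finset.univ.filter fun x => f x ∈ U
  have hcard : ∀ U, (pre U).card = d * U.card := card_filter_castHom_mem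
  have hpre : Function.Injective pre := by
    intro U V hUV
    ext u
    obtain ⟨x, rfl⟩ := hsurj u
    simpa [pre] using Finset.ext_iff.1 hUV x
  have hper : ∀ U, Function.IsPeriodicPt (shift (t * d)) t (pre U) := by
    intro U
    rw [Function.IsPeriodicPt, Function.IsFixedPt, shift_iterate]
    refine Finset.eq_of_subset_of_card_le ?_
      (Finset.card_image_of_injective _ (add_left_injective _)).ge
    intro x hx
    obtain ⟨y, hy, rfl⟩ := Finset.mem_image.1 hx
    simpa [pre] using hy
  have hexists : ∀ S, Function.IsPeriodicPt (shift (t * d)) t S → pre (S.image f) = S := by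
    intro S hS
    ext x
    simp only [pre, Finset.mem_filter, Finset.mem_univ, true_and, Finset.mem_image]
    refine ⟨?_, fun hx => ⟨x, hx, rfl⟩⟩
    rintro ⟨y, hy, hyx⟩
    have h0 : f (x - y) = 0 := by rw [map_sub, hyx, sub_self]
    rw [← ZMod.natCast_zmod_val (x - y), map_natCast, ZMod.natCast_eq_zero_iff] at h0
    have h1 := hS.trans_dvd h0
    rw [Function.IsPeriodicPt, Function.IsFixedPt, shift_iterate, ZMod.natCast_zmod_val] at h1
    rw [← h1]
    exact Finset.mem_image.2 ⟨y, hy, by ring⟩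
  split_ifs with hdk
  · obtain ⟨m, rfl⟩ := hdk
    rw [Nat.mul_div_cancel_left _ hd]
    have : (Finset.univ.powersetCard (d * m)).filter (fun S : Finset (ZMod (t * d)) =>
        Function.IsPeriodicPt (shift (t * d)) t S) = (Finset.univ.powersetCard m).image pre := by
      ext S
      simp only [Finset.mem_filter, Finset.mem_powersetCard, Finset.subset_univ, true_and,
        Finset.mem_image]
      constructor
      · rintro ⟨hS, hp⟩
        refine ⟨S.image f, ?_, hexists S hp⟩
        rw [← hexists S hp, hcard] at hS
        exact Nat.eq_of_mul_eq_mul_left hd hS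
      · rintro ⟨U, rfl, rfl⟩
        exact ⟨hcard U, hper U⟩
    rw [this, Finset.card_image_of_injective _ hpre, Finset.card_powersetCard, Finset.card_univ,
      ZMod.card]
  · rw [Finset.card_eq_zero, Finset.filter_eq_empty_iff]
    intro S hS hp
    rw [Finset.mem_powersetCard, ← hexists S hp, hcard] at hS
    exact hdk ⟨_, hS.2.symm⟩

theorem ite_lt_eq_neg_sum_moebius {n p : ℕ} (hn : 0 < n) (hp : p ∣ n) :
    (if p < n then 1 else 0 : ℤ) =
      -∑ d ∈ n.divisors.filter (fun d => 1 < d),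
        ArithmeticFunction.moebius d * (if p ∣ n / d then 1 else 0 : ℤ) := by
  obtain ⟨m, rfl⟩ := hp
  have hp0 : 0 < p := Nat.pos_of_mul_pos_right hn
  have hm0 : 0 < m := Nat.pos_of_mul_pos_left hn
  have hsplit : (p * m).divisors = insert 1 ((p * m).divisors.filter (fun d => 1 < d)) := by
    ext d
    simp only [Finset.mem_insert, Finset.mem_filter, Nat.mem_divisors]
    constructor
    · rintro h
      have := Nat.pos_of_dvd_of_pos h.1 hn
      by_cases hd : d = 1
      · exact Or.inl hd
      · exact Or.inr ⟨h, by omega⟩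
    · rintro (rfl | h)
      · exact ⟨one_dvd _, hn.ne'⟩
      · exact h.1
  have htot : ∑ d ∈ (p * m).divisors,
      ArithmeticFunction.moebius d * (if p ∣ p * m / d then 1 else 0 : ℤ) =
        if m = 1 then 1 else 0 := by
    have hsum : ∑ d ∈ m.divisors, ArithmeticFunction.moebius d = if m = 1 then 1 else 0 := by
      rw [← ArithmeticFunction.coe_mul_zeta_apply, ArithmeticFunction.moebius_mul_coe_zeta,
        ArithmeticFunction.one_apply]
    rw [← hsum, ← Nat.divisors_filter_dvd_of_dvd hn.ne' (dvd_mul_left m p), Finset.sum_filter]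
    refine Finset.sum_congr rfl fun d hd => ?_
    have hdn := Nat.dvd_of_mem_divisors hd
    have : p ∣ p * m / d ↔ d ∣ m := by
      rw [Nat.dvd_div_iff_mul_dvd hdn, mul_comm d p]
      exact Nat.mul_dvd_mul_iff_left hp0
    simp [this]
  rw [hsplit, Finset.sum_insert (by simp)] at htot
  simp only [ArithmeticFunction.moebius_apply_one, Nat.div_one, dvd_mul_right, if_true,
    mul_one] at htot
  have hlt : p < p * m ↔ m ≠ 1 := by
    constructor
    · rintro h rfl
      omega
    · intro h
      exact lt_mul_of_one_lt_right hp0 (by omega)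
  simp only [hlt]
  split_ifs at htot ⊢ <;> first | contradiction | linarith

/-- the number of diagrams `λ ∈ Y_{k,n}` with `o(λ) < n` equals
`-∑_{d ∣ gcd(k,n), d > 1} μ(d)·C(n/d, k/d)`. -/
theorem card_short_eq_neg_sum_moebius_choose (k n : ℕ) (hk : 1 ≤ k) (hkn : k ≤ n) :
    ({lam : Fin k → ℕ | IsDiagram k n lam ∧ orbLen k n lam < n}.ncard : ℤ) =
      -∑ d ∈ (Nat.gcd k n).divisors.filter (fun d => 1 < d),
        (ArithmeticFunction.moebius d) * (Nat.choose (n / d) (k / d) : ℤ) := by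
  have hn : 0 < n := by omega
  have : NeZero n := ⟨hn.ne'⟩
  have hcount : ∀ d ∈ n.divisors, (((Finset.univ.powersetCard k).filter
      fun S : Finset (ZMod n) => Function.IsPeriodicPt (shift n) (n / d) S).card : ℤ) =
        if d ∣ k then (Nat.choose (n / d) (k / d) : ℤ) else 0 := by
    intro d hd
    obtain ⟨t, ht⟩ := Nat.dvd_of_mem_divisors hd
    rw [mul_comm] at ht
    subst ht
    have hd0 : 0 < d := Nat.pos_of_mem_divisors hd
    have : NeZero t := ⟨by rintro rfl; simp at hn⟩
    rw [Nat.mul_div_cancel _ hd0, card_filter_isPeriodicPt]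
    split_ifs <;> simp
  rw [ncard_short_eq hk hkn, Finset.card_filter]
  push_cast
  rw [Finset.sum_congr rfl fun S _ => ite_lt_eq_neg_sum_moebius hn
    (shift_isPeriodicPt n S).minimalPeriod_dvd, Finset.sum_neg_distrib, Finset.sum_comm]
  congr 1
  have hgcd : (Nat.gcd k n).divisors.filter (fun d => 1 < d) =
      (n.divisors.filter (fun d => 1 < d)).filter (fun d => d ∣ k) := by
    ext d
    simp only [Finset.mem_filter, Nat.mem_divisors, Nat.dvd_gcd_iff, ne_eq, Nat.gcd_eq_zero_iff]
    constructor
    · rintro ⟨⟨⟨h1, h2⟩, -⟩, h3⟩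
      exact ⟨⟨⟨h2, hn.ne'⟩, h3⟩, h1⟩
    · rintro ⟨⟨⟨h2, -⟩, h3⟩, h1⟩
      exact ⟨⟨⟨h1, h2⟩, by omega⟩, h3⟩
  rw [hgcd, Finset.sum_filter (fun d => d ∣ k)]
  refine Finset.sum_congr rfl fun d hd => ?_
  rw [← Finset.mul_sum, Finset.sum_boole]
  simp only [← Function.isPeriodicPt_iff_minimalPeriod_dvd]
  rw [hcount d (Finset.mem_filter.1 hd).1, mul_ite, mul_zero]
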